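/- Let (Z,ρ₀) be an antipodal space, ρ₁, ρ₂ ∈ M(Z) and t ∈ [0,1]. Set ρ := P_∞(t·log(dρ₂/dρ₁), ρ₁) ∈ M(Z). Then d_M(ρ₁, ρ) = t·d_M(ρ₁, ρ₂) and d_M(ρ₂, ρ) = (1−t)·d_M(ρ₁, ρ₂). -/

import Mathlib

open Filter Topology
open scoped Classical

variable {Z : Type*}

/-- `Z` has at least four points. -/
def HasFourPoints (Z : Type*) : Prop :=
  ∃ a b c d : Z, a ≠ b ∧ a ≠ c ∧ a ≠ d ∧ b ≠ c ∧ b ≠ d ∧ c ≠ d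

/-- A separating function on `Z`: continuous, symmetric, and positive. -/
structure IsSeparating [TopologicalSpace Z] (ρ : Z → Z → ℝ) : Prop where
  continuous : Continuous fun p : Z × Z => ρ p.1 p.2
  symm : ∀ ξ η, ρ ξ η = ρ η ξ
  nonneg : ∀ ξ η, 0 ≤ ρ ξ η
  eq_zero_iff : ∀ ξ η, ρ ξ η = 0 ↔ ξ = η

/-- The cross-ratio of a quadruple of points with respect to `ρ`. -/
noncomputable def crossRatio (ρ : Z → Z → ℝ) (ξ ξ' η η' : Z) : ℝ :=
  ρ ξ η * ρ ξ' η' / (ρ ξ η' * ρ ξ' η)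

/-- Two functions are Moebius equivalent if their cross-ratios agree on all quadruples
of pairwise distinct points. -/
def MoebiusEquiv (ρ₁ ρ₂ : Z → Z → ℝ) : Prop :=
  ∀ ξ ξ' η η' : Z, ξ ≠ ξ' → ξ ≠ η → ξ ≠ η' → ξ' ≠ η → ξ' ≠ η' → η ≠ η' →
    crossRatio ρ₁ ξ ξ' η η' = crossRatio ρ₂ ξ ξ' η η'

/-- An antipodal function on `Z`: a separating function with values in `[0,1]` such that
every point has an antipode. -/
structure IsAntipodal [TopologicalSpace Z] (ρ : Z → Z → ℝ) : Prop where
  toIsSeparating : IsSeparating ρ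
  le_one : ∀ ξ η, ρ ξ η ≤ 1
  antipode : ∀ ξ, ∃ η, ρ ξ η = 1

/-- The Moebius space `M(Z, ρ₀)`: antipodal functions Moebius equivalent to `ρ₀`. -/
def MoebiusSpace [TopologicalSpace Z] (ρ₀ : Z → Z → ℝ) : Set (Z → Z → ℝ) :=
  {ρ | IsAntipodal ρ ∧ MoebiusEquiv ρ₀ ρ}

/-- The derivative `dρ₂/dρ₁`: the (unique, when it exists) positive continuous function
satisfying the geometric mean value theorem
`ρ₂(ξ,η)² = f(ξ) f(η) ρ₁(ξ,η)²`. -/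
noncomputable def mDeriv [TopologicalSpace Z] (ρ₁ ρ₂ : Z → Z → ℝ) : Z → ℝ :=
  if h : ∃ f : Z → ℝ, Continuous f ∧ (∀ ξ, 0 < f ξ) ∧
      ∀ ξ η, ρ₂ ξ η ^ 2 = f ξ * f η * ρ₁ ξ η ^ 2
  then h.choose else fun _ => 1

/-- The metric `d_M(ρ₁, ρ₂) = ‖log (dρ₂/dρ₁)‖_∞` on the Moebius space. -/
noncomputable def dM [TopologicalSpace Z] (ρ₁ ρ₂ : Z → Z → ℝ) : ℝ :=
  ⨆ ξ : Z, |Real.log (mDeriv ρ₁ ρ₂ ξ)|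

/-- The discrepancy function `D_{ρ₁}(τ)(ξ) = max_{η ≠ ξ} (τ(ξ) + τ(η) + log ρ₁(ξ,η)²)`. -/
noncomputable def discrepancy [TopologicalSpace Z] (ρ₁ : Z → Z → ℝ) (τ : C(Z, ℝ))
    (ξ : Z) : ℝ :=
  ⨆ η : {η : Z // η ≠ ξ}, (τ ξ + τ η.1 + Real.log (ρ₁ ξ η.1 ^ 2))

/-- `E_{ρ₁}(τ)(ξ,η) = e^{τ(ξ)/2} e^{τ(η)/2} ρ₁(ξ,η)`. -/
noncomputable def eMap [TopologicalSpace Z] (ρ₁ : Z → Z → ℝ) (τ : C(Z, ℝ)) :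
    Z → Z → ℝ :=
  fun ξ η => Real.exp (τ ξ / 2) * Real.exp (τ η / 2) * ρ₁ ξ η

/-- A solution of the `ρ₁`-antipodal flow `dτ_t/dt = -D_{ρ₁}(τ_t)` on `[0, ∞)`. -/
def IsAntipodalFlowSol [TopologicalSpace Z] [CompactSpace Z]
    (ρ₁ : Z → Z → ℝ) (τ : ℝ → C(Z, ℝ)) : Prop :=
  ∀ t ∈ Set.Ici (0 : ℝ), ∃ τ' : C(Z, ℝ),
    (∀ ξ, τ' ξ = -discrepancy ρ₁ (τ t) ξ) ∧
    HasDerivWithinAt τ τ' (Set.Ici (0 : ℝ)) t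

/-- The antipodalization map `P_∞(τ₀, ρ₁) = E_{ρ₁}(τ_∞)`, where `τ_∞` is the limit as
`t → ∞` of the solution of the `ρ₁`-antipodal flow starting at `τ₀`. -/
noncomputable def antipodalization [TopologicalSpace Z] [CompactSpace Z]
    (ρ₁ : Z → Z → ℝ) (τ₀ : C(Z, ℝ)) : Z → Z → ℝ :=
  if h : ∃ p : (ℝ → C(Z, ℝ)) × C(Z, ℝ), p.1 0 = τ₀ ∧ IsAntipodalFlowSol ρ₁ p.1 ∧
      Filter.Tendsto p.1 Filter.atTop (𝓝 p.2)
  then eMap ρ₁ h.choose.2 else ρ₁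


open scoped NNReal

lemma norm_integral_le_of_norm_le_exp {E : Type*} [NormedAddCommGroup E] [NormedSpace ℝ E]
    {u : ℝ → E} {B l m : ℝ} (hl : 0 < l) (hB : 0 ≤ B) (hm : 0 ≤ m)
    (hu : ∀ s ∈ Set.Ioc 0 m, ‖u s‖ ≤ B * Real.exp (l * s)) :
    ‖∫ s in (0 : ℝ)..m, u s‖ ≤ B / l * Real.exp (l * m) := by
  have hint : ∫ s in (0 : ℝ)..m, B * Real.exp (l * s)
      = B / l * Real.exp (l * m) - B / l * Real.exp (l * 0) := by
    refine intervalIntegral.integral_eq_sub_of_hasDerivAt (f := fun s => B / l * Real.exp (l * s))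
      (fun s _ => ?_) (Continuous.intervalIntegrable (by fun_prop) _ _)
    have := (((hasDerivAt_id s).const_mul l).exp).const_mul (B / l)
    refine this.congr_deriv ?_
    simp only [id]
    field_simp
  have := intervalIntegral.norm_integral_le_of_norm_le (μ := MeasureTheory.volume) hm
    (Filter.Eventually.of_forall hu)
    (Continuous.intervalIntegrable (by fun_prop : Continuous fun s => B * Real.exp (l * s))
      0 m)
  rw [hint] at this
  have h2 : 0 ≤ B / l * Real.exp (l * 0) := by positivity
  linarith

/-- The Picard operator for `x' = F x`, `x 0 = x₀` on `[0, ∞)`, conjugated by the weight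
`exp (l * t)`. -/
noncomputable def weightedPicard {E : Type*} [NormedAddCommGroup E] [NormedSpace ℝ E]
    (F : E → E) (x₀ : E) (l : ℝ) (y : ℝ → E) (t : ℝ) : E :=
  Real.exp (-(l * max t 0)) • (x₀ + ∫ s in (0 : ℝ)..max t 0, F (Real.exp (l * s) • y s))

/-- A globally Lipschitz autonomous differential equation in a Banach space has solutions
defined on all of `[0, ∞)`. -/
theorem LipschitzWith.exists_forall_hasDerivWithinAt_Ici {E : Type*} [NormedAddCommGroup E]
    [NormedSpace ℝ E] [CompleteSpace E] {K : ℝ≥0} {F : E → E} (hF : LipschitzWith K F)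
    (x₀ : E) :
    ∃ x : ℝ → E, x 0 = x₀ ∧
      ∀ t ∈ Set.Ici (0 : ℝ), HasDerivWithinAt x (F (x t)) (Set.Ici 0) t := by
  set l : ℝ := K + 1 with hl
  have hl0 : 0 < l := by positivity
  have hcont : ∀ y : BoundedContinuousFunction ℝ E,
      Continuous fun s => F (Real.exp (l * s) • y s) := fun y => by
    have := hF.continuous
    fun_prop
  have hP : ∀ y : BoundedContinuousFunction ℝ E, Continuous (weightedPicard F x₀ l y) := by
    intro y
    have h1 : Continuous fun m : ℝ => ∫ s in (0 : ℝ)..m, F (Real.exp (l * s) • y s) :=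
      intervalIntegral.continuous_primitive
        (fun a b => (hcont y).intervalIntegrable a b) 0
    have h2 : Continuous fun t : ℝ => max t 0 := by fun_prop
    exact Continuous.smul (by fun_prop) (continuous_const.add (h1.comp h2))
  have hbound : ∀ y : BoundedContinuousFunction ℝ E, ∀ t : ℝ,
      ‖weightedPicard F x₀ l y t‖ ≤ ‖x₀‖ + (‖F 0‖ + K * ‖y‖) / l := by
    intro y t
    have hm : 0 ≤ max t 0 := le_max_right _ _
    rw [weightedPicard, norm_smul, Real.norm_eq_abs, abs_of_pos (Real.exp_pos _)]
    have h1 := norm_integral_le_of_norm_le_exp (u := fun s => F (Real.exp (l * s) • y s))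
      (B := ‖F 0‖ + K * ‖y‖) hl0 (by positivity) hm (fun s hs => by
        have h3 : ‖F (Real.exp (l * s) • y s)‖ ≤ ‖F 0‖ + K * ‖Real.exp (l * s) • y s‖ := by
          have := hF.norm_sub_le (Real.exp (l * s) • y s) 0
          rw [sub_zero] at this
          linarith [norm_le_norm_add_norm_sub' (F (Real.exp (l * s) • y s)) (F 0)]
        rw [norm_smul, Real.norm_eq_abs, abs_of_pos (Real.exp_pos _)] at h3
        have h4 : 1 ≤ Real.exp (l * s) := Real.one_le_exp (by have := hs.1; positivity)
        have h5 : K * (Real.exp (l * s) * ‖y s‖) ≤ K * (Real.exp (l * s) * ‖y‖) := by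
          gcongr
          exact y.norm_coe_le_norm s
        nlinarith [norm_nonneg (F 0)])
    have hexp : Real.exp (-(l * max t 0)) ≤ 1 := Real.exp_le_one_iff.2 (by
      have := mul_nonneg hl0.le hm; linarith)
    have hmul : Real.exp (-(l * max t 0)) * Real.exp (l * max t 0) = 1 := by
      rw [← Real.exp_add]; simp
    calc _ ≤ Real.exp (-(l * max t 0)) *
          (‖x₀‖ + (‖F 0‖ + K * ‖y‖) / l * Real.exp (l * max t 0)) := by
            gcongr
            exact (norm_add_le _ _).trans (by gcongr)
      _ = Real.exp (-(l * max t 0)) * ‖x₀‖ + (‖F 0‖ + K * ‖y‖) / l := by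
            rw [mul_add, mul_comm _ (Real.exp (l * _)), ← mul_assoc, hmul, one_mul]
      _ ≤ _ := by nlinarith [norm_nonneg x₀]
  let T : BoundedContinuousFunction ℝ E → BoundedContinuousFunction ℝ E := fun y =>
    BoundedContinuousFunction.ofNormedAddCommGroup (weightedPicard F x₀ l y) (hP y) _ (hbound y)
  have hT : ContractingWith (K / (K + 1)) T := by
    refine ⟨by rw [div_lt_one (by positivity)]; simp, LipschitzWith.of_dist_le_mul
      fun y z => ?_⟩
    refine (BoundedContinuousFunction.dist_le (by positivity)).2 fun t => ?_
    have hm : 0 ≤ max t 0 := le_max_right _ _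
    have h1 := norm_integral_le_of_norm_le_exp
      (u := fun s => F (Real.exp (l * s) • y s) - F (Real.exp (l * s) • z s))
      (B := K * dist y z) hl0 (by positivity) hm (fun s hs => by
        refine (hF.norm_sub_le _ _).trans ?_
        rw [← smul_sub, norm_smul, Real.norm_eq_abs, abs_of_pos (Real.exp_pos _), ← dist_eq_norm,
          mul_assoc, mul_comm (dist y z)]
        gcongr
        exact y.dist_coe_le_dist s)
    have hmul : Real.exp (-(l * max t 0)) * Real.exp (l * max t 0) = 1 := by
      rw [← Real.exp_add]; simp
    rw [dist_eq_norm]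
    simp only [T, BoundedContinuousFunction.coe_ofNormedAddCommGroup, weightedPicard]
    rw [← smul_sub, norm_smul, Real.norm_eq_abs, abs_of_pos (Real.exp_pos _), add_sub_add_left_eq_sub,
      ← intervalIntegral.integral_sub ((hcont y).intervalIntegrable _ _)
        ((hcont z).intervalIntegrable _ _)]
    calc _ ≤ Real.exp (-(l * max t 0)) * (K * dist y z / l * Real.exp (l * max t 0)) := by
            gcongr
      _ = K * dist y z / l := by
            rw [mul_comm _ (Real.exp (l * _)), ← mul_assoc, hmul, one_mul]
      _ = _ := by
            push_cast
            rw [hl]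
            ring
  set y := ContractingWith.fixedPoint T hT with hy
  have hfix : ∀ t, weightedPicard F x₀ l y t = y t := fun t =>
    congrArg (fun z : BoundedContinuousFunction ℝ E => z t) hT.fixedPoint_isFixedPt
  have hsol : ∀ t ∈ Set.Ici (0 : ℝ), Real.exp (l * t) • y t
      = x₀ + ∫ s in (0 : ℝ)..t, F (Real.exp (l * s) • y s) := fun t ht => by
    rw [← hfix t, weightedPicard, max_eq_left ht, smul_smul, ← Real.exp_add]
    simp
  refine ⟨fun t => Real.exp (l * t) • y t, by simpa using hsol 0 (by simp), fun t ht => ?_⟩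
  have h1 := (((hcont y).integral_hasStrictDerivAt 0 t).hasDerivAt.const_add x₀).hasDerivWithinAt
    (s := Set.Ici 0)
  exact h1.congr hsol (hsol t ht)

/-! ### The geometric mean value theorem -/

lemma HasFourPoints.exists_ne_pair (h4 : HasFourPoints Z) (ξ η : Z) :
    ∃ a b : Z, a ≠ b ∧ a ≠ ξ ∧ b ≠ ξ ∧ a ≠ η ∧ b ≠ η := by
  obtain ⟨a, b, c, d, h⟩ := h4
  by_contra! h'
  have h1 := h' a b
  have h2 := h' a c
  have h3 := h' a d
  have h5 := h' b c
  have h6 := h' b d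
  have h7 := h' c d
  clear h'
  by_cases a = ξ <;> by_cases b = ξ <;> by_cases a = η <;> by_cases b = η <;> grind

lemma IsSeparating.pos [TopologicalSpace Z] {ρ : Z → Z → ℝ} (h : IsSeparating ρ) {ξ η : Z}
    (hne : ξ ≠ η) : 0 < ρ ξ η :=
  (h.nonneg ξ η).lt_of_ne fun h0 => hne ((h.eq_zero_iff ξ η).1 h0.symm)

/-- The candidate for the derivative `dρ₂/dρ₁` at `ξ`, where `r = ρ₂/ρ₁`, computed with
the help of two auxiliary points. -/
noncomputable def derivAux (r : Z → Z → ℝ) (ξ a b : Z) : ℝ := r ξ a * r ξ b / r a b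

section

variable {r : Z → Z → ℝ} (hsymm : ∀ ξ η, r ξ η = r η ξ) (hpos : ∀ ξ η, ξ ≠ η → 0 < r ξ η)
  (hcross : ∀ ξ ξ' η η' : Z, ξ ≠ ξ' → ξ ≠ η → ξ ≠ η' → ξ' ≠ η → ξ' ≠ η' → η ≠ η' →
    r ξ η * r ξ' η' = r ξ η' * r ξ' η)
include hpos hcross

lemma derivAux_eq_of_left {ξ a b c : Z} (ha : a ≠ ξ) (hb : b ≠ ξ) (hc : c ≠ ξ) (hab : a ≠ b)
    (hac : a ≠ c) : derivAux r ξ a b = derivAux r ξ a c := by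
  rcases eq_or_ne b c with rfl | hbc
  · rfl
  have := hcross ξ a b c ha.symm hb.symm hc.symm hab hac hbc
  rw [derivAux, derivAux, div_eq_div_iff (hpos _ _ hab).ne' (hpos _ _ hac).ne']
  linear_combination r ξ a * this

include hsymm

lemma derivAux_eq {ξ a b c d : Z} (ha : a ≠ ξ) (hb : b ≠ ξ) (hc : c ≠ ξ) (hd : d ≠ ξ)
    (hab : a ≠ b) (hcd : c ≠ d) : derivAux r ξ a b = derivAux r ξ c d := by
  rcases eq_or_ne a c with rfl | hac
  · exact derivAux_eq_of_left hpos hcross ha hb hd hab hcd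
  calc derivAux r ξ a b = derivAux r ξ a c :=
        derivAux_eq_of_left hpos hcross ha hb hc hab hac
    _ = derivAux r ξ c a := by rw [derivAux, derivAux, hsymm c a, mul_comm (r ξ a)]
    _ = _ := derivAux_eq_of_left hpos hcross hc ha hd hac.symm hcd

lemma derivAux_mul_derivAux {ξ η a b : Z} (hξη : ξ ≠ η) (haξ : a ≠ ξ) (hbξ : b ≠ ξ) (haη : a ≠ η)
    (hbη : b ≠ η) (hab : a ≠ b) : derivAux r ξ a b * derivAux r η a b = r ξ η ^ 2 := by
  have h1 := hcross ξ b a η hbξ.symm haξ.symm hξη hab.symm hbη haη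
  have h2 := hcross ξ a b η haξ.symm hbξ.symm hξη hab haη hbη
  have := (hpos _ _ hab).ne'
  rw [hsymm b η, hsymm b a] at h1
  rw [hsymm a η] at h2
  rw [derivAux, derivAux, div_mul_div_comm, div_eq_iff (by positivity)]
  linear_combination r ξ b * r η a * h1 + r ξ η * r a b * h2

end

/-- The geometric mean value theorem for Moebius equivalent separating functions. -/
theorem MoebiusEquiv.exists_deriv [TopologicalSpace Z] [T1Space Z] (h4 : HasFourPoints Z)
    {ρ₁ ρ₂ : Z → Z → ℝ} (h₁ : IsSeparating ρ₁) (h₂ : IsSeparating ρ₂)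
    (h : MoebiusEquiv ρ₁ ρ₂) :
    ∃ f : Z → ℝ, Continuous f ∧ (∀ ξ, 0 < f ξ) ∧
      ∀ ξ η, ρ₂ ξ η ^ 2 = f ξ * f η * ρ₁ ξ η ^ 2 := by
  set r : Z → Z → ℝ := fun ξ η => ρ₂ ξ η / ρ₁ ξ η with hr
  have hsymm : ∀ ξ η, r ξ η = r η ξ := fun ξ η => by simp only [hr, h₁.symm ξ, h₂.symm ξ]
  have hpos : ∀ ξ η, ξ ≠ η → 0 < r ξ η := fun ξ η hne => div_pos (h₂.pos hne) (h₁.pos hne)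
  have hcross : ∀ ξ ξ' η η' : Z, ξ ≠ ξ' → ξ ≠ η → ξ ≠ η' → ξ' ≠ η → ξ' ≠ η' → η ≠ η' →
      r ξ η * r ξ' η' = r ξ η' * r ξ' η := by
    intro ξ ξ' η η' a1 a2 a3 a4 a5 a6
    have := h ξ ξ' η η' a1 a2 a3 a4 a5 a6
    have p1 := (h₁.pos a2).ne'
    have p2 := (h₁.pos a3).ne'
    have p3 := (h₁.pos a4).ne'
    have p4 := (h₁.pos a5).ne'
    have q2 := (h₂.pos a3).ne'
    have q3 := (h₂.pos a4).ne'
    rw [crossRatio, crossRatio, div_eq_div_iff (by positivity) (by positivity)] at this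
    simp only [hr]
    rw [div_mul_div_comm, div_mul_div_comm, div_eq_div_iff (by positivity) (by positivity)]
    linear_combination -this
  choose a b hab haξ hbξ _ _ using fun ξ : Z => h4.exists_ne_pair ξ ξ
  set f : Z → ℝ := fun ξ => derivAux r ξ (a ξ) (b ξ) with hf
  have hf_eq : ∀ {ξ c d : Z}, c ≠ ξ → d ≠ ξ → c ≠ d → f ξ = derivAux r ξ c d :=
    fun hc hd hcd => derivAux_eq hsymm hpos hcross (haξ _) (hbξ _) hc hd (hab _) hcd
  refine ⟨f, ?_, fun ξ => ?_, fun ξ η => ?_⟩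
  · refine continuous_iff_continuousAt.2 fun ξ => ?_
    have hev : ∀ᶠ ζ in 𝓝 ξ, derivAux r ζ (a ξ) (b ξ) = f ζ := by
      filter_upwards [isOpen_ne.mem_nhds (haξ ξ).symm, isOpen_ne.mem_nhds (hbξ ξ).symm]
        with ζ ha hb
      exact (hf_eq (Ne.symm ha) (Ne.symm hb) (hab ξ)).symm
    refine ContinuousAt.congr ?_ hev
    have hρ : ∀ {ρ : Z → Z → ℝ}, IsSeparating ρ → ∀ c, ContinuousAt (fun ζ => ρ ζ c) ξ :=
      fun hs c => (hs.continuous.comp (by fun_prop : Continuous fun ζ => (ζ, c))).continuousAt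
    have hrc : ∀ c, c ≠ ξ → ContinuousAt (fun ζ => r ζ c) ξ := fun c hc =>
      (hρ h₂ c).div (hρ h₁ c) (h₁.pos hc.symm).ne'
    exact ((hrc _ (haξ ξ)).mul (hrc _ (hbξ ξ))).div_const _
  · exact div_pos (mul_pos (hpos _ _ (haξ ξ).symm) (hpos _ _ (hbξ ξ).symm)) (hpos _ _ (hab ξ))
  · rcases eq_or_ne ξ η with rfl | hne
    · simp [(h₁.eq_zero_iff ξ ξ).2 rfl, (h₂.eq_zero_iff ξ ξ).2 rfl]
    obtain ⟨c, d, hcd, hcξ, hdξ, hcη, hdη⟩ := h4.exists_ne_pair ξ η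
    rw [hf_eq hcξ hdξ hcd, hf_eq hcη hdη hcd,
      derivAux_mul_derivAux hsymm hpos hcross hne hcξ hdξ hcη hdη hcd, ← mul_pow, hr]
    simp only
    rw [div_mul_cancel₀ _ (h₁.pos hne).ne']

lemma mDeriv_spec [TopologicalSpace Z] {ρ₁ ρ₂ : Z → Z → ℝ}
    (h : ∃ f : Z → ℝ, Continuous f ∧ (∀ ξ, 0 < f ξ) ∧
      ∀ ξ η, ρ₂ ξ η ^ 2 = f ξ * f η * ρ₁ ξ η ^ 2) :
    Continuous (mDeriv ρ₁ ρ₂) ∧ (∀ ξ, 0 < mDeriv ρ₁ ρ₂ ξ) ∧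
      ∀ ξ η, ρ₂ ξ η ^ 2 = mDeriv ρ₁ ρ₂ ξ * mDeriv ρ₁ ρ₂ η * ρ₁ ξ η ^ 2 := by
  rw [mDeriv, dif_pos h]
  exact h.choose_spec

/-- Uniqueness of the derivative. -/
lemma mDeriv_eq_of_forall [TopologicalSpace Z] (h4 : HasFourPoints Z) {ρ₁ ρ₂ : Z → Z → ℝ}
    (h₁ : IsSeparating ρ₁) {f : Z → ℝ} (hc : Continuous f) (hpos : ∀ ξ, 0 < f ξ)
    (hf : ∀ ξ η, ρ₂ ξ η ^ 2 = f ξ * f η * ρ₁ ξ η ^ 2) : mDeriv ρ₁ ρ₂ = f := by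
  obtain ⟨-, hpos', hf'⟩ := mDeriv_spec ⟨f, hc, hpos, hf⟩
  funext ξ
  obtain ⟨a, b, hab, ha, hb, -, -⟩ := h4.exists_ne_pair ξ ξ
  have key : ∀ x y, x ≠ y → mDeriv ρ₁ ρ₂ x * mDeriv ρ₁ ρ₂ y = f x * f y := fun x y hxy =>
    mul_right_cancel₀ (pow_pos (h₁.pos hxy) 2).ne' ((hf' x y).symm.trans (hf x y))
  have k1 := key ξ a ha.symm
  have k2 := key ξ b hb.symm
  have k3 := key a b hab
  have hab' : (0 : ℝ) < f a * f b := mul_pos (hpos a) (hpos b)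
  have hsq : mDeriv ρ₁ ρ₂ ξ ^ 2 = f ξ ^ 2 := by
    refine mul_right_cancel₀ hab'.ne' ?_
    calc mDeriv ρ₁ ρ₂ ξ ^ 2 * (f a * f b)
        = (mDeriv ρ₁ ρ₂ ξ * mDeriv ρ₁ ρ₂ a) * (mDeriv ρ₁ ρ₂ ξ * mDeriv ρ₁ ρ₂ b) := by
          rw [← k3]; ring
      _ = _ := by rw [k1, k2]; ring
  exact (pow_left_inj₀ (hpos' ξ).le (hpos ξ).le two_ne_zero).1 hsq

/-- The distance between two functions differing by a conformal factor `exp τ`. -/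
lemma dM_eq_norm [TopologicalSpace Z] [CompactSpace Z] (h4 : HasFourPoints Z)
    {ρ₁ ρ₂ : Z → Z → ℝ} (h₁ : IsSeparating ρ₁) (τ : C(Z, ℝ))
    (hτ : ∀ ξ η, ρ₂ ξ η ^ 2 = Real.exp (τ ξ) * Real.exp (τ η) * ρ₁ ξ η ^ 2) :
    dM ρ₁ ρ₂ = ‖τ‖ := by
  rw [dM, mDeriv_eq_of_forall h4 h₁ (f := fun ξ => Real.exp (τ ξ)) (by fun_prop)
    (fun ξ => Real.exp_pos _) hτ, τ.norm_eq_iSup_norm]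
  simp

/-! ### The discrepancy -/

lemma IsSeparating.log_exp_mul_sq [TopologicalSpace Z] {ρ₁ : Z → Z → ℝ} (h₁ : IsSeparating ρ₁) (x : ℝ) {ξ η : Z}
    (hne : η ≠ ξ) :
    Real.log (Real.exp x * ρ₁ ξ η ^ 2) = x + Real.log (ρ₁ ξ η ^ 2) := by
  rw [Real.log_mul (Real.exp_pos _).ne' (pow_pos (h₁.pos hne.symm) 2).ne', Real.log_exp]

section

variable [TopologicalSpace Z] [CompactSpace Z]

lemma discrepancy_bddAbove {ρ₁ : Z → Z → ℝ} (h₁ : IsAntipodal ρ₁) (τ : C(Z, ℝ)) (ξ : Z) :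
    BddAbove (Set.range fun η : {η : Z // η ≠ ξ} =>
      τ ξ + τ η.1 + Real.log (ρ₁ ξ η.1 ^ 2)) := by
  refine ⟨‖τ‖ + ‖τ‖, ?_⟩
  rintro _ ⟨η, rfl⟩
  have h1 := (le_abs_self _).trans (τ.norm_coe_le_norm ξ)
  have h2 := (le_abs_self _).trans (τ.norm_coe_le_norm η.1)
  have h0 := h₁.toIsSeparating.nonneg ξ η.1
  have h3 : Real.log (ρ₁ ξ η.1 ^ 2) ≤ 0 :=
    Real.log_nonpos (sq_nonneg _) (pow_le_one₀ h0 (h₁.le_one _ _))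
  simp only
  linarith

lemma le_discrepancy {ρ₁ : Z → Z → ℝ} (h₁ : IsAntipodal ρ₁) (τ : C(Z, ℝ)) {ξ η : Z}
    (hne : η ≠ ξ) : τ ξ + τ η + Real.log (ρ₁ ξ η ^ 2) ≤ discrepancy ρ₁ τ ξ :=
  le_ciSup (discrepancy_bddAbove h₁ τ ξ) ⟨η, hne⟩

lemma IsSeparating.exists_isMaxOn {ρ₁ : Z → Z → ℝ} (h₁ : IsSeparating ρ₁)
    (h4 : HasFourPoints Z) (τ : C(Z, ℝ)) (ξ : Z) :
    ∃ η, η ≠ ξ ∧ ∀ ζ, Real.exp (τ ξ + τ ζ) * ρ₁ ξ ζ ^ 2 ≤ Real.exp (τ ξ + τ η) * ρ₁ ξ η ^ 2 := by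
  have hρ : Continuous fun ζ => ρ₁ ξ ζ :=
    h₁.continuous.comp (by fun_prop : Continuous fun ζ => (ξ, ζ))
  obtain ⟨a, -, -, ha, -⟩ := h4.exists_ne_pair ξ ξ
  obtain ⟨η, -, hη⟩ := isCompact_univ.exists_isMaxOn ⟨ξ, Set.mem_univ _⟩
    (by fun_prop : Continuous fun ζ => Real.exp (τ ξ + τ ζ) * ρ₁ ξ ζ ^ 2).continuousOn
  have hη' : ∀ ζ, Real.exp (τ ξ + τ ζ) * ρ₁ ξ ζ ^ 2 ≤ Real.exp (τ ξ + τ η) * ρ₁ ξ η ^ 2 :=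
    fun ζ => hη (Set.mem_univ ζ)
  refine ⟨η, ?_, hη'⟩
  rintro rfl
  have := hη' a
  rw [(h₁.eq_zero_iff η η).2 rfl] at this
  have h2 : 0 < Real.exp (τ η + τ a) * ρ₁ η a ^ 2 :=
    mul_pos (Real.exp_pos _) (pow_pos (h₁.pos ha.symm) 2)
  norm_num at this
  linarith

lemma exists_discrepancy_eq {ρ₁ : Z → Z → ℝ} (h₁ : IsAntipodal ρ₁) (h4 : HasFourPoints Z)
    (τ : C(Z, ℝ)) (ξ : Z) :
    ∃ η, η ≠ ξ ∧ discrepancy ρ₁ τ ξ = τ ξ + τ η + Real.log (ρ₁ ξ η ^ 2) := by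
  obtain ⟨η, hne, hη⟩ := h₁.toIsSeparating.exists_isMaxOn h4 τ ξ
  have : Nonempty {η : Z // η ≠ ξ} := ⟨⟨η, hne⟩⟩
  refine ⟨η, hne, le_antisymm (ciSup_le fun ζ => ?_) (le_discrepancy h₁ τ hne)⟩
  rw [← h₁.toIsSeparating.log_exp_mul_sq _ hne, ← h₁.toIsSeparating.log_exp_mul_sq _ ζ.2]
  exact Real.log_le_log
    (mul_pos (Real.exp_pos _) (pow_pos (h₁.toIsSeparating.pos ζ.2.symm) 2)) (hη ζ.1)

lemma discrepancy_eq_log_sSup {ρ₁ : Z → Z → ℝ} (h₁ : IsAntipodal ρ₁) (h4 : HasFourPoints Z)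
    (τ : C(Z, ℝ)) (ξ : Z) : discrepancy ρ₁ τ ξ
      = Real.log (sSup ((fun η => Real.exp (τ ξ + τ η) * ρ₁ ξ η ^ 2) '' Set.univ)) := by
  have h₁' := h₁.toIsSeparating
  obtain ⟨η, hne, hη⟩ := h₁'.exists_isMaxOn h4 τ ξ
  have hS : sSup ((fun η => Real.exp (τ ξ + τ η) * ρ₁ ξ η ^ 2) '' Set.univ)
      = Real.exp (τ ξ + τ η) * ρ₁ ξ η ^ 2 := by
    refine IsGreatest.csSup_eq ⟨⟨η, Set.mem_univ _, rfl⟩, ?_⟩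
    rintro _ ⟨ζ, -, rfl⟩
    exact hη ζ
  obtain ⟨ζ, hζ, hD⟩ := exists_discrepancy_eq h₁ h4 τ ξ
  refine le_antisymm ?_ ?_
  · rw [hS, hD, ← h₁'.log_exp_mul_sq _ hζ]
    exact Real.log_le_log (mul_pos (Real.exp_pos _) (pow_pos (h₁'.pos hζ.symm) 2)) (hη ζ)
  · rw [hS, h₁'.log_exp_mul_sq _ hne]
    exact le_discrepancy h₁ τ hne

lemma continuous_discrepancy {ρ₁ : Z → Z → ℝ} (h₁ : IsAntipodal ρ₁) (h4 : HasFourPoints Z)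
    (τ : C(Z, ℝ)) : Continuous (discrepancy ρ₁ τ) := by
  have h₁' := h₁.toIsSeparating
  have hc : Continuous fun ξ =>
      sSup ((fun η => Real.exp (τ ξ + τ η) * ρ₁ ξ η ^ 2) '' Set.univ) := by
    have hρ := h₁'.continuous
    refine IsCompact.continuous_sSup isCompact_univ
      (f := fun ξ η => Real.exp (τ ξ + τ η) * ρ₁ ξ η ^ 2) ?_
    change Continuous fun p : Z × Z => Real.exp (τ p.1 + τ p.2) * ρ₁ p.1 p.2 ^ 2
    fun_prop
  rw [funext (discrepancy_eq_log_sSup h₁ h4 τ)]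
  refine hc.log fun ξ => ?_
  obtain ⟨a, -, -, ha, -⟩ := h4.exists_ne_pair ξ ξ
  obtain ⟨η, -, hη⟩ := h₁'.exists_isMaxOn h4 τ ξ
  have ha' : 0 < Real.exp (τ ξ + τ a) * ρ₁ ξ a ^ 2 :=
    mul_pos (Real.exp_pos _) (pow_pos (h₁'.pos ha.symm) 2)
  have hbdd : BddAbove ((fun ζ => Real.exp (τ ξ + τ ζ) * ρ₁ ξ ζ ^ 2) '' Set.univ) :=
    ⟨_, by rintro _ ⟨ζ, -, rfl⟩; exact hη ζ⟩
  exact (ha'.trans_le (le_csSup hbdd ⟨a, Set.mem_univ a, rfl⟩)).ne'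

/-- An antipodal function `ρ₂` conformal to `ρ₁` gives a zero of the discrepancy. -/
lemma discrepancy_eq_zero {ρ₁ ρ₂ : Z → Z → ℝ} (h₁ : IsAntipodal ρ₁) (h₂ : IsAntipodal ρ₂)
    (h4 : HasFourPoints Z) (τ : C(Z, ℝ))
    (hτ : ∀ ξ η, ρ₂ ξ η ^ 2 = Real.exp (τ ξ) * Real.exp (τ η) * ρ₁ ξ η ^ 2) (ξ : Z) :
    discrepancy ρ₁ τ ξ = 0 := by
  have hval : ∀ η, η ≠ ξ → τ ξ + τ η + Real.log (ρ₁ ξ η ^ 2) = Real.log (ρ₂ ξ η ^ 2) :=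
    fun η hne => by rw [hτ, ← Real.exp_add, h₁.toIsSeparating.log_exp_mul_sq _ hne]
  refine le_antisymm ?_ ?_
  · obtain ⟨η, hne, hη⟩ := exists_discrepancy_eq h₁ h4 τ ξ
    rw [hη, hval η hne]
    exact Real.log_nonpos (sq_nonneg _)
      (pow_le_one₀ (h₂.toIsSeparating.nonneg _ _) (h₂.le_one _ _))
  · obtain ⟨η, hη⟩ := h₂.antipode ξ
    have hne : η ≠ ξ := by
      rintro rfl
      rw [(h₂.toIsSeparating.eq_zero_iff η η).2 rfl] at hη
      exact zero_ne_one hη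
    have := le_discrepancy h₁ τ hne
    rwa [hval η hne, hη, one_pow, Real.log_one] at this

lemma discrepancy_sub_le {ρ₁ : Z → Z → ℝ} (h₁ : IsAntipodal ρ₁) (h4 : HasFourPoints Z)
    (σ τ : C(Z, ℝ)) (ξ : Z) :
    discrepancy ρ₁ σ ξ - σ ξ - (discrepancy ρ₁ τ ξ - τ ξ) ≤ ‖σ - τ‖ := by
  obtain ⟨η, hne, hη⟩ := exists_discrepancy_eq h₁ h4 σ ξ
  have h1 := le_discrepancy h₁ τ hne
  have h2 := (le_abs_self _).trans ((σ - τ).norm_coe_le_norm η)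
  rw [ContinuousMap.sub_apply] at h2
  linarith

/-- The discrepancy as a self-map of `C(Z, ℝ)`. -/
noncomputable def discrepancyMap {ρ₁ : Z → Z → ℝ} (h₁ : IsAntipodal ρ₁) (h4 : HasFourPoints Z)
    (τ : C(Z, ℝ)) : C(Z, ℝ) :=
  ⟨discrepancy ρ₁ τ, continuous_discrepancy h₁ h4 τ⟩

lemma norm_discrepancyMap_sub_le {ρ₁ : Z → Z → ℝ} (h₁ : IsAntipodal ρ₁)
    (h4 : HasFourPoints Z) (σ τ : C(Z, ℝ)) :
    ‖discrepancyMap h₁ h4 σ - σ - (discrepancyMap h₁ h4 τ - τ)‖ ≤ ‖σ - τ‖ := by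
  refine (ContinuousMap.norm_le _ (norm_nonneg _)).2 fun ξ => abs_le.2 ⟨?_, ?_⟩
  · have := discrepancy_sub_le h₁ h4 τ σ ξ
    rw [norm_sub_rev] at this
    change -‖σ - τ‖ ≤ discrepancy ρ₁ σ ξ - σ ξ - (discrepancy ρ₁ τ ξ - τ ξ)
    linarith
  · exact discrepancy_sub_le h₁ h4 σ τ ξ

lemma lipschitzWith_neg_discrepancyMap {ρ₁ : Z → Z → ℝ} (h₁ : IsAntipodal ρ₁)
    (h4 : HasFourPoints Z) : LipschitzWith 2 fun τ => -discrepancyMap h₁ h4 τ := by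
  refine LipschitzWith.of_dist_le_mul fun σ τ => ?_
  rw [dist_neg_neg, dist_eq_norm, dist_eq_norm]
  have := norm_discrepancyMap_sub_le h₁ h4 σ τ
  have h2 : discrepancyMap h₁ h4 σ - discrepancyMap h₁ h4 τ
      = (discrepancyMap h₁ h4 σ - σ - (discrepancyMap h₁ h4 τ - τ)) + (σ - τ) := by abel
  rw [h2]
  refine (norm_add_le _ _).trans ?_
  push_cast
  linarith

/-! ### The antipodal flow -/

section

variable {ρ₁ : Z → Z → ℝ} {τ : ℝ → C(Z, ℝ)}

lemma IsAntipodalFlowSol.hasDerivWithinAt (hτ : IsAntipodalFlowSol ρ₁ τ) (h₁ : IsAntipodal ρ₁)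
    (h4 : HasFourPoints Z) {t : ℝ} (ht : t ∈ Set.Ici (0 : ℝ)) :
    HasDerivWithinAt τ (-discrepancyMap h₁ h4 (τ t)) (Set.Ici 0) t := by
  obtain ⟨τ', h, hd⟩ := hτ t ht
  convert hd
  ext ξ
  exact (h ξ).symm

lemma IsAntipodalFlowSol.hasDerivWithinAt_apply (hτ : IsAntipodalFlowSol ρ₁ τ)
    (h₁ : IsAntipodal ρ₁) (h4 : HasFourPoints Z) (ξ : Z) {t : ℝ} (ht : t ∈ Set.Ici (0 : ℝ)) :
    HasDerivWithinAt (fun s => τ s ξ) (-discrepancy ρ₁ (τ t) ξ) (Set.Ici 0) t :=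
  (ContinuousMap.evalCLM ℝ ξ : C(Z, ℝ) →L[ℝ] ℝ).hasFDerivAt.comp_hasDerivWithinAt t (hτ.hasDerivWithinAt h₁ h4 ht)

/-- The flow does not increase the distance to a stationary point. -/
lemma IsAntipodalFlowSol.norm_sub_le (hτ : IsAntipodalFlowSol ρ₁ τ)
    (h₁ : IsAntipodal ρ₁) (h4 : HasFourPoints Z) {σ : C(Z, ℝ)}
    (hσ : ∀ ξ, discrepancy ρ₁ σ ξ = 0) {t : ℝ} (ht : 0 ≤ t) : ‖τ t - σ‖ ≤ ‖τ 0 - σ‖ := by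
  have hσ' : discrepancyMap h₁ h4 σ = 0 := by
    ext ξ
    exact hσ ξ
  have hd : ∀ s ∈ Set.Ici (0 : ℝ), HasDerivWithinAt (fun s => Real.exp s • (τ s - σ))
      (Real.exp s • -discrepancyMap h₁ h4 (τ s) + Real.exp s • (τ s - σ)) (Set.Ici 0) s :=
    fun s hs => (Real.hasDerivAt_exp s).hasDerivWithinAt.smul
      ((hτ.hasDerivWithinAt h₁ h4 hs).sub_const σ)
  have key := norm_le_gronwallBound_of_norm_deriv_right_le (a := 0) (b := t) (K := 1) (ε := 0)
    (δ := ‖τ 0 - σ‖) (f := fun s => Real.exp s • (τ s - σ))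
    (fun s hs => ((hd s hs.1).continuousWithinAt).mono Set.Icc_subset_Ici_self)
    (fun s hs => (hd s hs.1).mono (Set.Ici_subset_Ici.2 hs.1)) (by simp) (fun s hs => by
      have h := norm_discrepancyMap_sub_le h₁ h4 (τ s) σ
      rw [hσ'] at h
      rw [← smul_add, norm_smul, norm_smul, one_mul, add_zero, ← norm_neg (_ + _)]
      refine mul_le_mul_of_nonneg_left ?_ (norm_nonneg _)
      have hv : -(-discrepancyMap h₁ h4 (τ s) + (τ s - σ))
          = discrepancyMap h₁ h4 (τ s) - τ s - (0 - σ) := by abel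
      rwa [hv]) t ⟨ht, le_rfl⟩
  rw [gronwallBound_ε0, norm_smul, Real.norm_eq_abs, abs_of_pos (Real.exp_pos _), one_mul,
    sub_zero, mul_comm] at key
  exact le_of_mul_le_mul_right key (Real.exp_pos _)

lemma hasDerivWithinAt_exp_mul (c a : ℝ) (s : Set ℝ) (t : ℝ) :
    HasDerivWithinAt (fun s => a * Real.exp (c * s)) (a * (Real.exp (c * t) * c)) s t := by
  have := (((hasDerivAt_id t).const_mul c).exp).const_mul a
  simpa using this.hasDerivWithinAt

lemma monotoneOn_Icc_of_hasDerivWithinAt_Ici {f f' : ℝ → ℝ} {T : ℝ}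
    (hf : ∀ t ∈ Set.Ici (0 : ℝ), HasDerivWithinAt f (f' t) (Set.Ici 0) t)
    (hf' : ∀ t ∈ Set.Icc 0 T, 0 ≤ f' t) : MonotoneOn f (Set.Icc 0 T) :=
  monotoneOn_of_hasDerivWithinAt_nonneg (convex_Icc 0 T)
    (fun t ht => (hf t ht.1).continuousWithinAt.mono Set.Icc_subset_Ici_self)
    (fun t ht => (hf t (interior_subset ht).1).mono
      (interior_subset.trans Set.Icc_subset_Ici_self))
    (fun t ht => hf' t (interior_subset ht))

/-- The positive part of the discrepancy decays like `exp (-2t)` along the flow. -/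
lemma IsAntipodalFlowSol.discrepancy_le (hτ : IsAntipodalFlowSol ρ₁ τ)
    (h₁ : IsAntipodal ρ₁) (h4 : HasFourPoints Z) {t : ℝ} (ht : 0 ≤ t) (ξ : Z) :
    discrepancy ρ₁ (τ t) ξ ≤ ‖discrepancyMap h₁ h4 (τ 0)‖ * Real.exp (-2 * t) := by
  obtain ⟨η, hne, hη⟩ := exists_discrepancy_eq h₁ h4 (τ t) ξ
  have hmono := monotoneOn_Icc_of_hasDerivWithinAt_Ici (T := t)
    (f := fun s => -((1 * Real.exp (2 * s)) * (τ s ξ + τ s η + Real.log (ρ₁ ξ η ^ 2))))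
    (fun s hs => ((hasDerivWithinAt_exp_mul 2 1 _ s).mul
      (((hτ.hasDerivWithinAt_apply h₁ h4 ξ hs).add
        (hτ.hasDerivWithinAt_apply h₁ h4 η hs)).add_const _)).neg) (fun s _ => by
      have e1 := le_discrepancy h₁ (τ s) hne
      have e2 := le_discrepancy h₁ (τ s) hne.symm
      rw [h₁.toIsSeparating.symm η ξ] at e2
      simp only [Pi.add_apply]
      nlinarith [Real.exp_pos (2 * s)])
  have h0t := hmono ⟨le_rfl, ht⟩ ⟨ht, le_rfl⟩ ht
  have e0 := le_discrepancy h₁ (τ 0) hne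
  have e1 := (le_abs_self _).trans ((discrepancyMap h₁ h4 (τ 0)).norm_coe_le_norm ξ)
  change discrepancy ρ₁ (τ 0) ξ ≤ _ at e1
  simp only [← hη, one_mul, mul_zero, Real.exp_zero] at h0t
  rw [neg_mul, Real.exp_neg, ← div_eq_mul_inv, le_div_iff₀ (Real.exp_pos _)]
  linarith

/-- The discrepancy decays exponentially along the flow. -/
lemma IsAntipodalFlowSol.abs_discrepancy_le (hτ : IsAntipodalFlowSol ρ₁ τ)
    (h₁ : IsAntipodal ρ₁) (h4 : HasFourPoints Z) {t : ℝ} (ht : 0 ≤ t) (ξ : Z) :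
    |discrepancy ρ₁ (τ t) ξ| ≤ 2 * ‖discrepancyMap h₁ h4 (τ 0)‖ * Real.exp (-1 * t) := by
  set C := ‖discrepancyMap h₁ h4 (τ 0)‖ with hC
  have hC0 : 0 ≤ C := norm_nonneg _
  have hup : ∀ s : ℝ, 0 ≤ s → ∀ ζ, discrepancy ρ₁ (τ s) ζ ≤ C * Real.exp (-2 * s) :=
    fun s hs ζ => hτ.discrepancy_le h₁ h4 hs ζ
  have hshift : ∀ s, 0 ≤ s → s ≤ t → discrepancy ρ₁ (τ s) ξ - τ s ξ - C / 2 * Real.exp (-2 * s)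
      ≤ discrepancy ρ₁ (τ t) ξ - τ t ξ - C / 2 * Real.exp (-2 * t) := by
    intro s hs hst
    obtain ⟨η, hne, hη⟩ := exists_discrepancy_eq h₁ h4 (τ s) ξ
    have hmono := monotoneOn_Icc_of_hasDerivWithinAt_Ici (T := t)
      (f := fun s => τ s η - C / 2 * Real.exp (-2 * s))
      (fun s hs => (hτ.hasDerivWithinAt_apply h₁ h4 η hs).sub
        (hasDerivWithinAt_exp_mul (-2) (C / 2) _ s)) (fun s hs => by
          linarith [hup s hs.1 η])
    have h1 := hmono ⟨hs, hst⟩ ⟨ht, le_rfl⟩ hst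
    have h2 := le_discrepancy h₁ (τ t) hne
    simp only at h1
    linarith
  have hexp : ∀ s : ℝ, Real.exp s * Real.exp (-2 * s) = Real.exp (-1 * s) := fun s => by
    rw [← Real.exp_add]; ring_nf
  set H := discrepancy ρ₁ (τ t) ξ - τ t ξ - C / 2 * Real.exp (-2 * t) with hH
  have hmono := monotoneOn_Icc_of_hasDerivWithinAt_Ici (T := t)
    (f := fun s => (1 * Real.exp (1 * s)) * (τ s ξ + H) - C / 2 * Real.exp (-1 * s))
    (fun s hs => ((hasDerivWithinAt_exp_mul 1 1 _ s).mul
      ((hτ.hasDerivWithinAt_apply h₁ h4 ξ hs).add_const H)).sub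
        (hasDerivWithinAt_exp_mul (-1) (C / 2) _ s)) (fun s hs => by
      have h1 := mul_le_mul_of_nonneg_left (hshift s hs.1 hs.2) (Real.exp_pos s).le
      have h2 := hexp s
      simp only [one_mul, mul_one]
      nlinarith)
  have h0t := hmono ⟨le_rfl, ht⟩ ⟨ht, le_rfl⟩ ht
  have h0 := hshift 0 le_rfl ht
  have e1 := (abs_le.1 ((discrepancyMap h₁ h4 (τ 0)).norm_coe_le_norm ξ)).1
  change -C ≤ discrepancy ρ₁ (τ 0) ξ at e1
  simp only [one_mul, mul_zero, Real.exp_zero, mul_one] at h0t h0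
  refine abs_le.2 ⟨?_, (hup t ht ξ).trans ?_⟩
  · have hprod : Real.exp t * Real.exp (-1 * t) = 1 := by
      rw [← Real.exp_add]; simp
    have h5 : τ t ξ + H = discrepancy ρ₁ (τ t) ξ - C / 2 * Real.exp (-2 * t) := by
      rw [hH]; ring
    rw [h5, mul_sub] at h0t
    have h6 := hexp t
    have h7 : -(2 * C) ≤ Real.exp t * discrepancy ρ₁ (τ t) ξ := by
      have : Real.exp t * (C / 2 * Real.exp (-2 * t)) = C / 2 * Real.exp (-1 * t) := by
        rw [← h6]; ring
      nlinarith [mul_nonneg hC0 (Real.exp_pos (-1 * t)).le]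
    have h8 := mul_le_mul_of_nonneg_right h7 (Real.exp_pos (-1 * t)).le
    have h9 : Real.exp t * discrepancy ρ₁ (τ t) ξ * Real.exp (-1 * t)
        = discrepancy ρ₁ (τ t) ξ := by
      linear_combination discrepancy ρ₁ (τ t) ξ * hprod
    linarith
  · have h1 : Real.exp (-2 * t) ≤ Real.exp (-1 * t) := Real.exp_le_exp.2 (by linarith)
    nlinarith [Real.exp_pos (-1 * t)]

/-- Every solution of the antipodal flow converges. -/
lemma IsAntipodalFlowSol.exists_tendsto (hτ : IsAntipodalFlowSol ρ₁ τ)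
    (h₁ : IsAntipodal ρ₁) (h4 : HasFourPoints Z) : ∃ τ', Tendsto τ atTop (𝓝 τ') := by
  set C := 2 * ‖discrepancyMap h₁ h4 (τ 0)‖ with hC
  have hC0 : 0 ≤ C := by positivity
  have hdist : ∀ s t : ℝ, 0 ≤ s → s ≤ t → dist (τ s) (τ t) ≤ C * Real.exp (-1 * s) := by
    intro s t hs hst
    refine (ContinuousMap.dist_le (by positivity)).2 fun ξ => ?_
    have hD : ∀ r : ℝ, 0 ≤ r → |discrepancy ρ₁ (τ r) ξ| ≤ C * Real.exp (-1 * r) :=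
      fun r hr => hτ.abs_discrepancy_le h₁ h4 hr ξ
    have m1 := monotoneOn_Icc_of_hasDerivWithinAt_Ici (T := t)
      (f := fun s => τ s ξ - C * Real.exp (-1 * s))
      (fun s hs => (hτ.hasDerivWithinAt_apply h₁ h4 ξ hs).sub
        (hasDerivWithinAt_exp_mul (-1) C _ s)) (fun r hr => by
          linarith [(abs_le.1 (hD r hr.1)).2])
    have m2 := monotoneOn_Icc_of_hasDerivWithinAt_Ici (T := t)
      (f := fun s => -(τ s ξ) - C * Real.exp (-1 * s))
      (fun s hs => (hτ.hasDerivWithinAt_apply h₁ h4 ξ hs).neg.sub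
        (hasDerivWithinAt_exp_mul (-1) C _ s)) (fun r hr => by
          linarith [(abs_le.1 (hD r hr.1)).1])
    have e1 := m1 ⟨hs, hst⟩ ⟨hs.trans hst, le_rfl⟩ hst
    have e2 := m2 ⟨hs, hst⟩ ⟨hs.trans hst, le_rfl⟩ hst
    have e3 : 0 ≤ C * Real.exp (-1 * t) := by positivity
    simp only at e1 e2
    exact abs_le.2 ⟨by linarith, by linarith⟩
  have hzero : Tendsto (fun s : ℝ => C * Real.exp (-1 * s)) atTop (𝓝 0) := by
    have := (Real.tendsto_exp_neg_atTop_nhds_zero).const_mul C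
    simpa using this
  have hcauchy : Cauchy (map τ atTop) := by
    refine Metric.cauchy_iff.2 ⟨inferInstance, fun ε hε => ?_⟩
    obtain ⟨N, hN, hN0⟩ := ((hzero.eventually_lt_const (half_pos hε)).and
      (eventually_ge_atTop 0)).exists
    refine ⟨τ '' Set.Ici N, image_mem_map (Ici_mem_atTop N), ?_⟩
    rintro _ ⟨s, hs, rfl⟩ _ ⟨t, ht, rfl⟩
    calc dist (τ s) (τ t) ≤ dist (τ N) (τ s) + dist (τ N) (τ t) := dist_triangle_left _ _ _
      _ < ε := by linarith [hdist N s hN0 hs, hdist N t hN0 ht]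
  exact CompleteSpace.complete hcauchy

/-- The antipodalization is `E(σ)` for the limit `σ` of some solution of the flow. -/
lemma antipodalization_spec (h₁ : IsAntipodal ρ₁) (h4 : HasFourPoints Z) (τ₀ : C(Z, ℝ)) :
    ∃ (τ : ℝ → C(Z, ℝ)) (σ : C(Z, ℝ)), τ 0 = τ₀ ∧ IsAntipodalFlowSol ρ₁ τ ∧
      Tendsto τ atTop (𝓝 σ) ∧ antipodalization ρ₁ τ₀ = eMap ρ₁ σ := by
  have h : ∃ p : (ℝ → C(Z, ℝ)) × C(Z, ℝ), p.1 0 = τ₀ ∧ IsAntipodalFlowSol ρ₁ p.1 ∧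
      Tendsto p.1 atTop (𝓝 p.2) := by
    obtain ⟨τ, h0, hd⟩ :=
      (lipschitzWith_neg_discrepancyMap h₁ h4).exists_forall_hasDerivWithinAt_Ici τ₀
    have hτ : IsAntipodalFlowSol ρ₁ τ := fun t ht => ⟨_, fun _ => rfl, hd t ht⟩
    obtain ⟨σ, hσ⟩ := hτ.exists_tendsto h₁ h4
    exact ⟨(τ, σ), h0, hτ, hσ⟩
  obtain ⟨a, b, c⟩ := h.choose_spec
  exact ⟨h.choose.1, h.choose.2, a, b, c, by rw [antipodalization, dif_pos h]⟩

end

end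

lemma eMap_sq [TopologicalSpace Z] (ρ₁ : Z → Z → ℝ) (τ : C(Z, ℝ)) (ξ η : Z) :
    eMap ρ₁ τ ξ η ^ 2 = Real.exp (τ ξ) * Real.exp (τ η) * ρ₁ ξ η ^ 2 := by
  have h : ∀ x : ℝ, Real.exp x = Real.exp (x / 2) ^ 2 := fun x => by
    rw [← Real.exp_nat_mul]; push_cast; ring_nf
  rw [eMap, h (τ ξ), h (τ η)]
  ring

theorem statement12 [TopologicalSpace Z] [CompactSpace Z]
    [TopologicalSpace.MetrizableSpace Z] (h4 : HasFourPoints Z)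
    (ρ₀ : Z → Z → ℝ) (h₀ : IsAntipodal ρ₀)
    (ρ₁ ρ₂ : Z → Z → ℝ) (hρ₁ : ρ₁ ∈ MoebiusSpace ρ₀) (hρ₂ : ρ₂ ∈ MoebiusSpace ρ₀)
    (t : ℝ) (ht : t ∈ Set.Icc (0 : ℝ) 1)
    (g : C(Z, ℝ)) (hg : ∀ ξ, g ξ = Real.log (mDeriv ρ₁ ρ₂ ξ)) :
    dM ρ₁ (antipodalization ρ₁ (t • g)) = t * dM ρ₁ ρ₂ ∧
    dM ρ₂ (antipodalization ρ₁ (t • g)) = (1 - t) * dM ρ₁ ρ₂ := by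
  obtain ⟨ha₁, he₁⟩ := hρ₁
  obtain ⟨ha₂, he₂⟩ := hρ₂
  have hs₁ := ha₁.toIsSeparating
  have hs₂ := ha₂.toIsSeparating
  have he : MoebiusEquiv ρ₁ ρ₂ := fun ξ ξ' η η' a b c d e f =>
    (he₁ ξ ξ' η η' a b c d e f).symm.trans (he₂ ξ ξ' η η' a b c d e f)
  obtain ⟨-, hpos, hderiv⟩ := mDeriv_spec (he.exists_deriv h4 hs₁ hs₂)
  have hg₁₂ : ∀ ξ η, ρ₂ ξ η ^ 2 = Real.exp (g ξ) * Real.exp (g η) * ρ₁ ξ η ^ 2 := fun ξ η => by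
    rw [hg, hg, Real.exp_log (hpos ξ), Real.exp_log (hpos η), hderiv]
  obtain ⟨τ, σ, h0, hτ, hlim, hE⟩ := antipodalization_spec ha₁ h4 (t • g)
  have hle : ∀ κ : C(Z, ℝ), (∀ ξ, discrepancy ρ₁ κ ξ = 0) → ‖σ - κ‖ ≤ ‖t • g - κ‖ :=
    fun κ hκ => le_of_tendsto (hlim.sub_const κ).norm <| by
      filter_upwards [eventually_ge_atTop 0] with s hs
      exact h0 ▸ hτ.norm_sub_le ha₁ h4 hκ hs
  have hle₁ : ‖σ‖ ≤ t * ‖g‖ := by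
    have := hle 0 (discrepancy_eq_zero ha₁ ha₁ h4 0 (by simp))
    rwa [sub_zero, sub_zero, norm_smul, Real.norm_of_nonneg ht.1] at this
  have hle₂ : ‖σ - g‖ ≤ (1 - t) * ‖g‖ := by
    have := hle g (discrepancy_eq_zero ha₁ ha₂ h4 g hg₁₂)
    have hsub : t • g - g = -((1 - t) • g) := by rw [sub_smul, one_smul, neg_sub]
    rwa [hsub, norm_neg, norm_smul, Real.norm_of_nonneg (sub_nonneg.2 ht.2)] at this
  have htri : ‖g‖ ≤ ‖σ‖ + ‖σ - g‖ := norm_le_norm_add_norm_sub σ g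
  rw [hE, dM_eq_norm h4 hs₁ g hg₁₂, dM_eq_norm h4 hs₁ σ (eMap_sq ρ₁ σ),
    dM_eq_norm h4 hs₂ (σ - g) (fun ξ η => ?_)]
  · exact ⟨by linarith, by linarith⟩
  · rw [eMap_sq, hg₁₂, ContinuousMap.sub_apply, ContinuousMap.sub_apply, Real.exp_sub, Real.exp_sub]
    field_simp
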